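/- Let r ≥ 3 be an integer and let G be a coloured graph on n vertices that is RK_r-free and BK_{r+1}-free and satisfies δ(G) > ((14r−24)/(7r−5))·n. If every edge of G of weight 1 is secure and every edge of G of weight 0 is secure, then G contains no wicked triangle. -/

import Mathlib

/-- A coloured graph structure on a weight function: symmetric, `{0,1,2}`-valued,
vanishing on the diagonal. -/
def IsColoured {V : Type*} (w : V → V → ℕ) : Prop :=
  (∀ x y, w x y = w y x) ∧ (∀ x y, w x y ≤ 2) ∧ (∀ x, w x x = 0)

/-- The coloured graph with weight function `f` on `Fin m` is a subgraph of `(V, w)`. -/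
def HasSub {V : Type*} (w : V → V → ℕ) {m : ℕ} (f : Fin m → Fin m → ℕ) : Prop :=
  ∃ φ : Fin m → V, Function.Injective φ ∧ ∀ x y, f x y ≤ w (φ x) (φ y)

/-- The red clique `RK_m`: every edge has weight `2`. -/
def RK (m : ℕ) : Fin m → Fin m → ℕ := fun x y => if x = y then 0 else 2

/-- The blue clique `BK_m`: every edge has weight `1`. -/
def BK (m : ℕ) : Fin m → Fin m → ℕ := fun x y => if x = y then 0 else 1

/-- The coloured graph `G_{t,i}` of order `t - i`: a red clique `RK_i` (the first `i`
vertices) and a blue clique `BK_{t-2i}`, joined by edges of weight `1`. -/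
def Gt (t i : ℕ) : Fin (t - i) → Fin (t - i) → ℕ :=
  fun x y => if x = y then 0 else if x.val < i ∧ y.val < i then 2 else 1

/-- `(V, w)` is `𝓕_t`-free, where `𝓕_t = {G_{t,i} : 1 ≤ i ≤ t/2}`. -/
def FamFree {V : Type*} (w : V → V → ℕ) (t : ℕ) : Prop :=
  ∀ i, 1 ≤ i → 2 * i ≤ t → ¬ HasSub w (Gt t i)

/-- An `𝓕_{2r}`-free coloured graph `(V, w)` is extremal if every `𝓕_{2r}`-free coloured
graph on `V` whose weight function pointwise dominates `w` coincides with `w`. -/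
def Extremal {V : Type*} (w : V → V → ℕ) (r : ℕ) : Prop :=
  FamFree w (2 * r) ∧
    ∀ w' : V → V → ℕ, IsColoured w' → (∀ x y, w x y ≤ w' x y) → FamFree w' (2 * r) → w' = w

/-- A pair of distinct vertices `x, y` is secure if it lies in the common red
neighbourhood of some red clique on `r - 2` vertices. -/
def Secure {V : Type*} (w : V → V → ℕ) (r : ℕ) (x y : V) : Prop :=
  ∃ A : Finset V, A.card = r - 2 ∧ x ∉ A ∧ y ∉ A ∧
    (∀ a ∈ A, ∀ a' ∈ A, a ≠ a' → w a a' = 2) ∧ (∀ a ∈ A, w a x = 2 ∧ w a y = 2)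

open Finset

section ColouredGraph

variable {V : Type*}

/-- The vertices of `S` are pairwise joined by edges of weight `2`. -/
def RedClique (w : V → V → ℕ) (S : Finset V) : Prop :=
  ∀ a ∈ S, ∀ b ∈ S, a ≠ b → w a b = 2

/-- The vertices of `S` are pairwise joined by edges of positive weight. -/
def PosClique (w : V → V → ℕ) (S : Finset V) : Prop :=
  ∀ a ∈ S, ∀ b ∈ S, a ≠ b → w a b ≠ 0

/-- The combined assumptions on a coloured graph, with forbidden cliques expressed by finsets
and the degree condition expressed by the complementary degree `∑ u, (2 - w u v)`. -/
structure DenseFree [Fintype V] (w : V → V → ℕ) (r : ℕ) : Prop where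
  three_le : 3 ≤ r
  symm : ∀ x y, w x y = w y x
  le_two : ∀ x y, w x y ≤ 2
  diag : ∀ x, w x x = 0
  red_free : ∀ S, RedClique w S → S.card ≠ r
  pos_free : ∀ S, PosClique w S → S.card ≠ r + 1
  codegree_lt : ∀ v, 7 * r * ∑ u, (2 - w u v) < 14 * Fintype.card V + 5 * ∑ u, (2 - w u v)

/-- `A` is a red clique on `r - 2` vertices in the common red neighbourhood of `p` and `q`. -/
structure Link (w : V → V → ℕ) (r : ℕ) (p q : V) (A : Finset V) : Prop where
  card_eq : A.card + 2 = r
  red : RedClique w A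
  left : ∀ a ∈ A, w p a = 2
  right : ∀ a ∈ A, w q a = 2

/-- A wicked triangle `(x, y, z)` with links `A` of `x, z` and `B` of `y, z` whose
intersection is as large as possible. -/
structure Frame [DecidableEq V] (w : V → V → ℕ) (r : ℕ) (x y z : V) (A B : Finset V) :
    Prop where
  xy : w x y = 2
  xz : w x z ≤ 1
  yz : w y z ≤ 1
  linkA : Link w r x z A
  linkB : Link w r y z B
  maximal : ∀ A' B', Link w r x z A' → Link w r y z B' → (A' ∩ B').card ≤ (A ∩ B).card

lemma exists_fin_embedding {S : Finset V} {m : ℕ} (h : S.card = m) :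
    ∃ φ : Fin m → V, Function.Injective φ ∧ ∀ i, φ i ∈ S :=
  ⟨fun i => ((S.equivFinOfCardEq h).symm i : V),
    Subtype.val_injective.comp (Equiv.injective _), fun _ => Subtype.coe_prop _⟩

lemma RedClique.hasSub_RK {w : V → V → ℕ} {S : Finset V} {m : ℕ} (hS : RedClique w S)
    (h : S.card = m) : HasSub w (RK m) := by
  obtain ⟨φ, hφ, hmem⟩ := exists_fin_embedding h
  refine ⟨φ, hφ, fun i j => ?_⟩
  by_cases hij : i = j
  · simp [RK, hij]
  · simp [RK, hij, hS _ (hmem i) _ (hmem j) (hφ.ne hij)]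

lemma PosClique.hasSub_BK {w : V → V → ℕ} {S : Finset V} {m : ℕ} (hS : PosClique w S)
    (h : S.card = m) : HasSub w (BK m) := by
  obtain ⟨φ, hφ, hmem⟩ := exists_fin_embedding h
  refine ⟨φ, hφ, fun i j => ?_⟩
  by_cases hij : i = j
  · simp [BK, hij]
  · have := hS _ (hmem i) _ (hmem j) (hφ.ne hij)
    simp only [BK, hij, if_false]
    omega

lemma denseFree_of_minDegree [Fintype V] {w : V → V → ℕ} {r : ℕ} (hr : 3 ≤ r)
    (hG : IsColoured w) (hRK : ¬ HasSub w (RK r)) (hBK : ¬ HasSub w (BK (r + 1)))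
    (hdeg : ∀ x : V,
      (14 * (r : ℝ) - 24) / (7 * (r : ℝ) - 5) * (Fintype.card V : ℝ) < ∑ y : V, (w x y : ℝ)) :
    DenseFree w r where
  three_le := hr
  symm := hG.1
  le_two := hG.2.1
  diag := hG.2.2
  red_free := fun S hS h => hRK (hS.hasSub_RK h)
  pos_free := fun S hS h => hBK (hS.hasSub_BK h)
  codegree_lt := by
    intro v
    have hr' : (3 : ℝ) ≤ r := by exact_mod_cast hr
    have hpos : (0 : ℝ) < 7 * r - 5 := by linarith
    have h1 : ((∑ u, (2 - w u v) : ℕ) : ℝ) = 2 * Fintype.card V - ∑ y : V, (w v y : ℝ) := by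
      rw [Nat.cast_sum, eq_sub_iff_add_eq, ← sum_add_distrib]
      have : ∀ u ∈ (univ : Finset V), ((2 - w u v : ℕ) : ℝ) + (w v u : ℝ) = 2 := by
        intro u _
        rw [hG.1 v u, Nat.cast_sub (hG.2.1 u v)]
        push_cast
        ring
      rw [sum_congr rfl this]
      simp [mul_comm]
    have h2 := hdeg v
    rw [div_mul_eq_mul_div, div_lt_iff₀ hpos] at h2
    have h3 : (7 * r * (∑ u, (2 - w u v) : ℕ) : ℝ) <
        14 * Fintype.card V + 5 * (∑ u, (2 - w u v) : ℕ) := by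
      rw [h1]
      linarith
    exact_mod_cast h3

lemma le_sum_of_mem (f : V → ℕ) {S : Finset V} {a : V} (ha : a ∈ S) : f a ≤ ∑ v ∈ S, f v :=
  single_le_sum (fun _ _ => Nat.zero_le _) ha

lemma add_le_sum_of_mem [DecidableEq V] (f : V → ℕ) {S : Finset V} {a b : V} (ha : a ∈ S)
    (hb : b ∈ S) (hab : a ≠ b) : f a + f b ≤ ∑ v ∈ S, f v := by
  rw [← sum_pair hab]
  exact sum_le_sum_of_subset (by simp [insert_subset_iff, ha, hb])

lemma add_add_le_sum_of_mem [DecidableEq V] (f : V → ℕ) {S : Finset V} {a b c : V}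
    (ha : a ∈ S) (hb : b ∈ S) (hc : c ∈ S) (hab : a ≠ b) (hac : a ≠ c) (hbc : b ≠ c) :
    f a + f b + f c ≤ ∑ v ∈ S, f v := by
  have h : ∑ v ∈ ({a, b, c} : Finset V), f v = f a + f b + f c := by
    rw [sum_insert (by simp [hab, hac]), sum_pair hbc, add_assoc]
  rw [← h]
  exact sum_le_sum_of_subset (by simp [insert_subset_iff, ha, hb, hc])

namespace DenseFree

variable [Fintype V] {w : V → V → ℕ} {r : ℕ}

lemma exists_sum_lt (hG : DenseFree w r) {m : ℕ} (p : Fin m → ℕ) (S : Fin m → Finset V) (L : ℕ)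
    (hpos : 0 < ∑ i, p i * (S i).card)
    (hL : 14 * ∑ i, p i * (S i).card + 5 * L ≤ 7 * r * L) :
    ∃ u, ∑ i, p i * ∑ v ∈ S i, (2 - w u v) < L := by
  by_contra! hcon
  set F := ∑ i, p i * (S i).card with hF
  set n := Fintype.card V with hn
  set T := ∑ i, p i * ∑ v ∈ S i, ∑ u, (2 - w u v) with hT
  have h1 : n * L ≤ T := by
    have : T = ∑ u, ∑ i, p i * ∑ v ∈ S i, (2 - w u v) := by
      rw [sum_comm, hT]
      refine sum_congr rfl fun i _ => ?_
      rw [← mul_sum, sum_comm]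
    rw [this, hn, ← smul_eq_mul, ← card_univ]
    exact card_nsmul_le_sum _ _ _ fun u _ => hcon u
  have h2 : ∀ i, p i * ∑ v ∈ S i, ((7 * r : ℤ) - 5) * ((∑ u, (2 - w u v) : ℕ) : ℤ) +
      p i * (S i).card ≤ 14 * n * (p i * (S i).card) := by
    intro i
    have hv : ∀ v ∈ S i, ((7 * r : ℤ) - 5) * ((∑ u, (2 - w u v) : ℕ) : ℤ) ≤ 14 * n - 1 := by
      intro v _
      have := hG.codegree_lt v
      zify at this ⊢
      linarith
    have := sum_le_card_nsmul _ _ _ hv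
    rw [nsmul_eq_mul] at this
    have hp : (0 : ℤ) ≤ p i := by positivity
    have := mul_le_mul_of_nonneg_left this hp
    linarith
  have h3 := sum_le_sum fun i (_ : i ∈ (univ : Finset (Fin m))) => h2 i
  rw [sum_add_distrib, ← mul_sum] at h3
  have h4 : ∑ i, (p i : ℤ) * ∑ v ∈ S i, ((7 * r : ℤ) - 5) * ((∑ u, (2 - w u v) : ℕ) : ℤ) =
      ((7 * r : ℤ) - 5) * T := by
    rw [hT]
    push_cast
    rw [mul_sum]
    refine sum_congr rfl fun i _ => ?_
    rw [← mul_sum]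
    ring
  have h5 : ∑ i, (p i : ℤ) * ((S i).card : ℤ) = F := by
    rw [hF]
    push_cast
    rfl
  rw [h4, h5] at h3
  have hr : (3 : ℤ) ≤ r := by exact_mod_cast hG.three_le
  have h6 : ((7 * r : ℤ) - 5) * (n * L) ≤ ((7 * r : ℤ) - 5) * T := by
    apply mul_le_mul_of_nonneg_left _ (by linarith)
    exact_mod_cast h1
  have h7 : (14 : ℤ) * F + 5 * L ≤ 7 * r * L := by exact_mod_cast hL
  have h8 : (n : ℤ) * (14 * F + 5 * L) ≤ n * (7 * r * L) :=
    mul_le_mul_of_nonneg_left h7 (by positivity)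
  have h9 : (0 : ℤ) < F := by exact_mod_cast hpos
  linarith

lemma notMem_of_pos (hG : DenseFree w r) {S : Finset V} {u : V}
    (hu : ∀ a ∈ S, w u a ≠ 0) : u ∉ S :=
  fun h => hu u h (hG.diag u)

variable [DecidableEq V]

lemma redClique_insert (hG : DenseFree w r) {S : Finset V} {u : V} (hS : RedClique w S)
    (hu : ∀ a ∈ S, w u a = 2) : RedClique w (insert u S) := by
  intro a ha b hb hab
  rw [mem_insert] at ha hb
  rcases ha with rfl | ha <;> rcases hb with rfl | hb
  · exact absurd rfl hab
  · exact hu b hb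
  · rw [hG.symm]; exact hu a ha
  · exact hS a ha b hb hab

lemma posClique_insert (hG : DenseFree w r) {S : Finset V} {u : V} (hS : PosClique w S)
    (hu : ∀ a ∈ S, w u a ≠ 0) : PosClique w (insert u S) := by
  intro a ha b hb hab
  rw [mem_insert] at ha hb
  rcases ha with rfl | ha <;> rcases hb with rfl | hb
  · exact absurd rfl hab
  · exact hu b hb
  · rw [hG.symm]; exact hu a ha
  · exact hS a ha b hb hab

lemma exists_ne_two (hG : DenseFree w r) {S : Finset V} (hS : RedClique w S)
    (hc : S.card + 1 = r) (u : V) : ∃ a ∈ S, w u a ≠ 2 := by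
  by_contra! h
  have hu : u ∉ S := hG.notMem_of_pos fun a ha => by rw [h a ha]; omega
  exact hG.red_free _ (hG.redClique_insert hS h) (by rw [card_insert_of_notMem hu, hc])

lemma exists_eq_zero (hG : DenseFree w r) {S : Finset V} (hS : PosClique w S)
    (hc : S.card = r) (u : V) : ∃ a ∈ S, w u a = 0 := by
  by_contra! h
  exact hG.pos_free _ (hG.posClique_insert hS h)
    (by rw [card_insert_of_notMem (hG.notMem_of_pos h), hc])

lemma exists_blue_neighbour (hG : DenseFree w r) {S : Finset V} (hS : RedClique w S)
    (hc : S.card + 1 = r) : ∃ v, ∃ e ∈ S, w v e = 1 := by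
  have hr := hG.three_le
  obtain ⟨v, hv⟩ := hG.exists_sum_lt (fun _ : Fin 1 => 1) (fun _ => S) 2
    (by simp [-card_pos]; omega) (by simp; omega)
  simp only [univ_unique, one_mul, sum_const, card_singleton, one_smul] at hv
  obtain ⟨e, he, hve⟩ := hG.exists_ne_two hS hc v
  have := le_sum_of_mem (fun a => 2 - w v a) he
  have := hG.le_two v e
  exact ⟨v, e, he, by omega⟩

end DenseFree

lemma RedClique.posClique {w : V → V → ℕ} {S : Finset V} (hS : RedClique w S) :
    PosClique w S :=
  fun a ha b hb hab => by rw [hS a ha b hb hab]; omega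

namespace Link

variable {w : V → V → ℕ} {r : ℕ} {p q : V} {A : Finset V}

lemma swap (h : Link w r p q A) : Link w r q p A :=
  ⟨h.card_eq, h.red, h.right, h.left⟩

variable [Fintype V]

lemma left_notMem (h : Link w r p q A) (hG : DenseFree w r) : p ∉ A :=
  hG.notMem_of_pos fun a ha => by rw [h.left a ha]; omega

variable [DecidableEq V]

lemma redClique_insert (h : Link w r p q A) (hG : DenseFree w r) :
    RedClique w (insert p A) :=
  hG.redClique_insert h.red h.left

lemma card_insert (h : Link w r p q A) (hG : DenseFree w r) : (insert p A).card + 1 = r := by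
  rw [card_insert_of_notMem (h.left_notMem hG)]
  exact h.card_eq

lemma ne_two (h : Link w r p q A) (hG : DenseFree w r) (u : V) :
    w u p ≠ 2 ∨ ∃ a ∈ A, w u a ≠ 2 := by
  obtain ⟨a, ha, hua⟩ := hG.exists_ne_two (h.redClique_insert hG) (h.card_insert hG) u
  rcases mem_insert.1 ha with rfl | ha
  · exact Or.inl hua
  · exact Or.inr ⟨a, ha, hua⟩

lemma eq_zero (h : Link w r p q A) (hG : DenseFree w r) (hpq : w p q = 1) (u : V) :
    w u p = 0 ∨ w u q = 0 ∨ ∃ a ∈ A, w u a = 0 := by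
  have hp : ∀ a ∈ insert q A, w p a ≠ 0 := by
    intro a ha
    rcases mem_insert.1 ha with rfl | ha
    · omega
    · rw [h.left a ha]; omega
  have hK := hG.posClique_insert (h.swap.redClique_insert hG).posClique hp
  have hc : (insert p (insert q A)).card = r := by
    rw [card_insert_of_notMem (hG.notMem_of_pos hp)]
    exact h.swap.card_insert hG
  obtain ⟨a, ha, hua⟩ := hG.exists_eq_zero hK hc u
  simp only [mem_insert] at ha
  rcases ha with rfl | rfl | ha
  · exact Or.inl hua
  · exact Or.inr (Or.inl hua)
  · exact Or.inr (Or.inr ⟨a, ha, hua⟩)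

lemma replace (h : Link w r p q A) (hG : DenseFree w r) {a u : V} (ha : a ∈ A)
    (hp : w u p = 2) (hq : w u q = 2) (hu : ∀ b ∈ A, b ≠ a → w u b = 2) :
    Link w r p q (insert u (A.erase a)) := by
  have hu' : ∀ b ∈ A.erase a, w u b = 2 := fun b hb =>
    hu b (mem_of_mem_erase hb) (ne_of_mem_erase hb)
  have hmem : u ∉ A.erase a := hG.notMem_of_pos fun b hb => by rw [hu' b hb]; omega
  refine ⟨?_, hG.redClique_insert (fun b hb c hc => h.red b (mem_of_mem_erase hb) c
    (mem_of_mem_erase hc)) hu', fun b hb => ?_, fun b hb => ?_⟩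
  · rw [card_insert_of_notMem hmem, card_erase_add_one ha, h.card_eq]
  · rcases mem_insert.1 hb with rfl | hb
    · rw [hG.symm, hp]
    · exact h.left b (mem_of_mem_erase hb)
  · rcases mem_insert.1 hb with rfl | hb
    · rw [hG.symm, hq]
    · exact h.right b (mem_of_mem_erase hb)

end Link

namespace Frame

variable [DecidableEq V] {w : V → V → ℕ} {r : ℕ} {x y z : V} {A B : Finset V}

lemma card_sdiff (h : Frame w r x y z A B) : (A ∩ B).card + (A \ B).card + 2 = r := by
  rw [card_inter_add_card_sdiff]
  exact h.linkA.card_eq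

lemma card_sdiff' (h : Frame w r x y z A B) : (A ∩ B).card + (B \ A).card + 2 = r := by
  rw [inter_comm, card_inter_add_card_sdiff]
  exact h.linkB.card_eq

/-- The vertices of a frame outside the common part of the two links. -/
def outer (x y z : V) (A B : Finset V) : Finset V :=
  insert x (insert y (insert z (A \ B ∪ B \ A)))

lemma mem_outer {v : V} :
    v ∈ outer x y z A B ↔ v = x ∨ v = y ∨ v = z ∨ v ∈ A \ B ∨ v ∈ B \ A := by
  simp only [outer, mem_insert, mem_union]

lemma card_outer_le : (outer x y z A B).card ≤ (A \ B).card + (B \ A).card + 3 := by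
  have h1 := card_insert_le x (insert y (insert z (A \ B ∪ B \ A)))
  have h2 := card_insert_le y (insert z (A \ B ∪ B \ A))
  have h3 := card_insert_le z (A \ B ∪ B \ A)
  have h4 := card_union_le (A \ B) (B \ A)
  unfold outer
  omega

lemma card_outer_pos : 0 < (outer x y z A B).card :=
  card_pos.2 ⟨x, mem_insert_self _ _⟩

end Frame

lemma exists_frame [Fintype V] [DecidableEq V] {w : V → V → ℕ} {r : ℕ}
    {x y z : V} (hxy : w x y = 2) (hxz : w x z ≤ 1) (hyz : w y z ≤ 1)
    (hA : ∃ A, Link w r x z A) (hB : ∃ B, Link w r y z B) : ∃ A B, Frame w r x y z A B := by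
  classical
  obtain ⟨A, hA⟩ := hA
  obtain ⟨B, hB⟩ := hB
  obtain ⟨P, hP, hmax⟩ := exists_max_image
    (univ.filter fun P : Finset V × Finset V => Link w r x z P.1 ∧ Link w r y z P.2)
    (fun P => (P.1 ∩ P.2).card) ⟨(A, B), by simp [hA, hB]⟩
  simp only [mem_filter, mem_univ, true_and] at hP hmax
  exact ⟨P.1, P.2, hxy, hxz, hyz, hP.1, hP.2, fun A' B' hA' hB' => hmax (A', B') ⟨hA', hB'⟩⟩

namespace Frame

variable [Fintype V] [DecidableEq V] {w : V → V → ℕ} {r : ℕ} {x y z : V} {A B : Finset V}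

lemma swap (h : Frame w r x y z A B) (hG : DenseFree w r) : Frame w r y x z B A :=
  ⟨by rw [hG.symm, h.xy], h.yz, h.xz, h.linkB, h.linkA, fun A' B' hA' hB' => by
    rw [inter_comm A' B', inter_comm B A]
    exact h.maximal B' A' hB' hA'⟩

lemma card_sdiff_pos (h : Frame w r x y z A B) (hG : DenseFree w r) : 0 < (A \ B).card := by
  rw [card_pos, nonempty_iff_ne_empty]
  intro hAB
  rcases h.linkA.ne_two hG y with hy | ⟨a, ha, hya⟩
  · exact hy (by rw [hG.symm, h.xy])
  · exact hya (h.linkB.left a (sdiff_eq_empty_iff_subset.1 hAB ha))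

/-- The maximality of the intersection of the two links. -/
lemma not_replace (h : Frame w r x y z A B) (hG : DenseFree w r) {a b u : V}
    (ha : a ∈ A \ B) (hb : b ∈ B \ A) (hx : w u x = 2) (hy : w u y = 2) (hz : w u z = 2)
    (huA : ∀ a' ∈ A, a' ≠ a → w u a' = 2) (huB : ∀ b' ∈ B, b' ≠ b → w u b' = 2) : False := by
  rw [mem_sdiff] at ha hb
  have hA := h.linkA.replace hG ha.1 hx hz huA
  have hB := h.linkB.replace hG hb.1 hy hz huB
  have hu : u ∉ A ∩ B := hG.notMem_of_pos fun c hc => by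
    rw [mem_inter] at hc
    rw [huA c hc.1 fun hca => ha.2 (hca ▸ hc.2)]
    omega
  have hsub : insert u (A ∩ B) ⊆ insert u (A.erase a) ∩ insert u (B.erase b) := by
    intro c hc
    rw [mem_insert, mem_inter] at hc
    simp only [mem_inter, mem_insert, mem_erase]
    rcases hc with rfl | ⟨hcA, hcB⟩
    · simp
    · exact ⟨Or.inr ⟨fun hca => ha.2 (hca ▸ hcB), hcA⟩,
        Or.inr ⟨fun hcb => hb.2 (hcb ▸ hcA), hcB⟩⟩
  have h1 := card_le_card hsub
  rw [card_insert_of_notMem hu] at h1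
  have h2 := h.maximal _ _ hA hB
  omega

end Frame

lemma DenseFree.inter_loss [Fintype V] [DecidableEq V] {w : V → V → ℕ} {r : ℕ}
    (hG : DenseFree w r) (C : Finset V) (u : V) :
    2 ≤ ∑ v ∈ C, (2 - w u v) ∨ (1 ≤ ∑ v ∈ C, (2 - w u v) ∧ ∀ c ∈ C, w u c ≠ 0) ∨
      ∀ c ∈ C, w u c = 2 := by
  by_cases h2 : 2 ≤ ∑ v ∈ C, (2 - w u v)
  · exact Or.inl h2
  by_cases h1 : 1 ≤ ∑ v ∈ C, (2 - w u v)
  · refine Or.inr (Or.inl ⟨h1, fun c hc h0 => ?_⟩)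
    have := le_sum_of_mem (fun a => 2 - w u a) hc
    omega
  · refine Or.inr (Or.inr fun c hc => ?_)
    have := le_sum_of_mem (fun a => 2 - w u a) hc
    have := hG.le_two u c
    omega

lemma exists_mem_sdiff [DecidableEq V] {A B : Finset V} {P : V → Prop} (h : ∃ a ∈ A, P a)
    (hC : ∀ c ∈ A ∩ B, ¬ P c) : ∃ a ∈ A \ B, P a := by
  obtain ⟨a, ha, hPa⟩ := h
  exact ⟨a, mem_sdiff.2 ⟨ha, fun hB => hC a (mem_inter.2 ⟨ha, hB⟩) hPa⟩, hPa⟩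

namespace Frame

variable [Fintype V] [DecidableEq V] {w : V → V → ℕ} {r : ℕ} {x y z : V} {A B : Finset V}

lemma left_ne_two (h : Frame w r x y z A B) (hG : DenseFree w r) {u : V}
    (hC : ∀ c ∈ A ∩ B, w u c = 2) : w u x ≠ 2 ∨ ∃ a ∈ A \ B, w u a ≠ 2 :=
  (h.linkA.ne_two hG u).imp_right fun h => exists_mem_sdiff h fun c hc h => h (hC c hc)

lemma apex_ne_two (h : Frame w r x y z A B) (hG : DenseFree w r) {u : V}
    (hC : ∀ c ∈ A ∩ B, w u c = 2) : w u z ≠ 2 ∨ ∃ a ∈ A \ B, w u a ≠ 2 :=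
  (h.linkA.swap.ne_two hG u).imp_right fun h => exists_mem_sdiff h fun c hc h => h (hC c hc)

lemma left_eq_zero (h : Frame w r x y z A B) (hG : DenseFree w r) (hxz : w x z = 1) {u : V}
    (hC : ∀ c ∈ A ∩ B, w u c ≠ 0) : w u x = 0 ∨ w u z = 0 ∨ ∃ a ∈ A \ B, w u a = 0 :=
  (h.linkA.eq_zero hG hxz u).imp_right fun h =>
    h.imp_right fun h => exists_mem_sdiff h hC

lemma third_ne_two (h : Frame w r x y z A B) (hG : DenseFree w r) {u a b : V}
    (hC : ∀ c ∈ A ∩ B, w u c = 2) (ha : a ∈ A \ B) (hb : b ∈ B \ A) :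
    w u x ≠ 2 ∨ w u y ≠ 2 ∨ w u z ≠ 2 ∨ (∃ a' ∈ A \ B, a' ≠ a ∧ w u a' ≠ 2) ∨
      ∃ b' ∈ B \ A, b' ≠ b ∧ w u b' ≠ 2 := by
  by_contra! hcon
  obtain ⟨hx, hy, hz, hA, hB⟩ := hcon
  refine h.not_replace hG ha hb hx hy hz (fun a' ha' hne => ?_) (fun b' hb' hne => ?_)
  · by_cases h' : a' ∈ B
    · exact hC a' (mem_inter.2 ⟨ha', h'⟩)
    · exact hA a' (mem_sdiff.2 ⟨ha', h'⟩) hne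
  · by_cases h' : b' ∈ A
    · exact hC b' (mem_inter.2 ⟨h', hb'⟩)
    · exact hB b' (mem_sdiff.2 ⟨hb', h'⟩) hne

lemma blue_blue (h : Frame w r x y z A B) (hG : DenseFree w r) (hxz : w x z = 1)
    (hyz : w y z = 1) : False := by
  have hA := h.card_sdiff
  have hB := h.card_sdiff'
  have hm := h.card_sdiff_pos hG
  obtain ⟨u, hu⟩ := hG.exists_sum_lt ![7, 3, 3, 3, 3, 4]
    ![A ∩ B, A \ B, B \ A, {x}, {y}, {z}] 14 (by simp [Fin.sum_univ_succ])
    (by simp [Fin.sum_univ_succ]; omega)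
  simp [Fin.sum_univ_succ] at hu
  have hlA : ∀ a ∈ A \ B, 2 - w u a ≤ ∑ v ∈ A \ B, (2 - w u v) := fun a ha =>
    le_sum_of_mem (fun v => 2 - w u v) ha
  have hlB : ∀ a ∈ B \ A, 2 - w u a ≤ ∑ v ∈ B \ A, (2 - w u v) := fun a ha =>
    le_sum_of_mem (fun v => 2 - w u v) ha
  have hle := hG.le_two u
  have hux := hle x
  have huy := hle y
  have huz := hle z
  rcases hG.inter_loss (A ∩ B) u with hC | ⟨hC1, hC⟩ | hC
  · omega
  · have zA : w u x = 0 ∨ w u z = 0 ∨ 2 ≤ ∑ v ∈ A \ B, (2 - w u v) :=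
      (h.left_eq_zero hG hxz hC).imp_right fun h => h.imp_right fun ⟨a, ha, h0⟩ => by
        have := hlA a ha; omega
    have zB : w u y = 0 ∨ w u z = 0 ∨ 2 ≤ ∑ v ∈ B \ A, (2 - w u v) :=
      ((h.swap hG).left_eq_zero hG hyz (by rwa [inter_comm])).imp_right fun h =>
        h.imp_right fun ⟨a, ha, h0⟩ => by have := hlB a ha; omega
    omega
  · have hC' : ∀ c ∈ B ∩ A, w u c = 2 := by rwa [inter_comm]
    have n1 : w u x ≠ 2 ∨ 1 ≤ ∑ v ∈ A \ B, (2 - w u v) :=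
      (h.left_ne_two hG hC).imp_right fun ⟨a, ha, h0⟩ => by
        have := hlA a ha; have := hle a; omega
    have n2 : w u z ≠ 2 ∨ 1 ≤ ∑ v ∈ A \ B, (2 - w u v) :=
      (h.apex_ne_two hG hC).imp_right fun ⟨a, ha, h0⟩ => by
        have := hlA a ha; have := hle a; omega
    have n3 : w u y ≠ 2 ∨ 1 ≤ ∑ v ∈ B \ A, (2 - w u v) :=
      ((h.swap hG).left_ne_two hG hC').imp_right fun ⟨a, ha, h0⟩ => by
        have := hlB a ha; have := hle a; omega
    have n4 : w u z ≠ 2 ∨ 1 ≤ ∑ v ∈ B \ A, (2 - w u v) :=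
      ((h.swap hG).apex_ne_two hG hC').imp_right fun ⟨a, ha, h0⟩ => by
        have := hlB a ha; have := hle a; omega
    rcases h.left_eq_zero hG hxz (fun c hc => by rw [hC c hc]; omega) with h1 | h1 | ⟨a, ha, h1⟩
    · rcases (h.swap hG).left_eq_zero hG hyz (fun c hc => by rw [hC' c hc]; omega) with
        h2 | h2 | ⟨b, hb, h2⟩
      · omega
      · omega
      · have := hlB b hb
        omega
    · omega
    · have := hlA a ha
      rcases (h.swap hG).left_eq_zero hG hyz (fun c hc => by rw [hC' c hc]; omega) with
        h2 | h2 | ⟨b, hb, h2⟩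
      · omega
      · omega
      · have := hlB b hb
        rcases h.third_ne_two hG hC ha hb with h3 | h3 | h3 | ⟨a', ha', hne, h3⟩ |
          ⟨b', hb', hne, h3⟩
        · omega
        · omega
        · omega
        · have := add_le_sum_of_mem (fun v => 2 - w u v) ha' ha hne
          have := hle a'
          omega
        · have := add_le_sum_of_mem (fun v => 2 - w u v) hb' hb hne
          have := hle b'
          omega

lemma blue_of_no_blue_blue (h : Frame w r x y z A B) (hG : DenseFree w r) (hxz : w x z = 1)
    (hW : ∀ s t v, w s t = 2 → w s v = 1 → w t v ≠ 1) : False := by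
  have hA := h.card_sdiff
  have hB := h.card_sdiff'
  have hm := h.card_sdiff_pos hG
  obtain ⟨u, hu⟩ := hG.exists_sum_lt ![7, 4, 2, 4, 2, 4]
    ![A ∩ B, A \ B, B \ A, {x}, {y}, {z}] 14 (by simp [Fin.sum_univ_succ])
    (by simp [Fin.sum_univ_succ]; omega)
  simp [Fin.sum_univ_succ] at hu
  have hlA : ∀ a ∈ A \ B, 2 - w u a ≤ ∑ v ∈ A \ B, (2 - w u v) := fun a ha =>
    le_sum_of_mem (fun v => 2 - w u v) ha
  have hlB : ∀ a ∈ B \ A, 2 - w u a ≤ ∑ v ∈ B \ A, (2 - w u v) := fun a ha =>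
    le_sum_of_mem (fun v => 2 - w u v) ha
  have hle := hG.le_two u
  have hux := hle x
  have huy := hle y
  have huz := hle z
  have hedge : ∀ s t, w s t = 2 → w u s ≠ 2 → w u t ≠ 2 → w u s + w u t ≤ 1 := by
    intro s t hst h1 h2
    have := hW s t u hst
    rw [hG.symm s u, hG.symm t u] at this
    have := hle s
    have := hle t
    omega
  rcases hG.inter_loss (A ∩ B) u with hC | ⟨hC1, hC⟩ | hC
  · omega
  · rcases h.left_eq_zero hG hxz hC with h1 | h1 | ⟨a, ha, h1⟩
    · omega
    · omega
    · have := hlA a ha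
      omega
  · have hC' : ∀ c ∈ B ∩ A, w u c = 2 := by rwa [inter_comm]
    have n1 : w u x ≠ 2 ∨ 1 ≤ ∑ v ∈ A \ B, (2 - w u v) :=
      (h.left_ne_two hG hC).imp_right fun ⟨a, ha, h0⟩ => by
        have := hlA a ha; have := hle a; omega
    have n2 : w u z ≠ 2 ∨ 1 ≤ ∑ v ∈ A \ B, (2 - w u v) :=
      (h.apex_ne_two hG hC).imp_right fun ⟨a, ha, h0⟩ => by
        have := hlA a ha; have := hle a; omega
    have n3 : w u y ≠ 2 ∨ 1 ≤ ∑ v ∈ B \ A, (2 - w u v) :=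
      ((h.swap hG).left_ne_two hG hC').imp_right fun ⟨a, ha, h0⟩ => by
        have := hlB a ha; have := hle a; omega
    have q1 := hW u x z
    have q2 := hW u z x
    rw [hG.symm z x] at q2
    rcases (h.swap hG).apex_ne_two hG hC' with h4 | ⟨b, hb, h4⟩
    · rcases h.left_eq_zero hG hxz (fun c hc => by rw [hC c hc]; omega) with
        h1 | h1 | ⟨a, ha, h1⟩
      · omega
      · omega
      · have := hlA a ha
        omega
    · have := hlB b hb
      have := hle b
      rcases h.left_eq_zero hG hxz (fun c hc => by rw [hC c hc]; omega) with
        h1 | h1 | ⟨a, ha, h1⟩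
      · omega
      · omega
      · have := hlA a ha
        rcases h.third_ne_two hG hC ha hb with h3 | h3 | h3 | ⟨a', ha', hne, h3⟩ |
          ⟨b', hb', hne, h3⟩
        · omega
        · have := hedge y b (h.linkB.left b (mem_sdiff.1 hb).1) h3 h4
          omega
        · omega
        · have := add_le_sum_of_mem (fun v => 2 - w u v) ha' ha hne
          have := hle a'
          omega
        · have := add_le_sum_of_mem (fun v => 2 - w u v) hb' hb hne
          have := hedge b' b (h.linkB.red b' (mem_sdiff.1 hb').1 b (mem_sdiff.1 hb).1 hne) h3 h4
          omega

lemma left_notMem (h : Frame w r x y z A B) (hG : DenseFree w r) : x ∉ B := by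
  intro hx
  have := h.linkB.right x hx
  rw [hG.symm] at this
  have := h.xz
  omega

lemma exists_three (h : Frame w r x y z A B) (hG : DenseFree w r) {u : V}
    (hC : ∀ c ∈ A ∩ B, w u c = 2) :
    ∃ p ∈ outer x y z A B, ∃ q ∈ outer x y z A B, ∃ t ∈ outer x y z A B,
      p ≠ q ∧ p ≠ t ∧ q ≠ t ∧ w u p ≠ 2 ∧ w u q ≠ 2 ∧ w u t ≠ 2 := by
  have hC' : ∀ c ∈ B ∩ A, w u c = 2 := by rwa [inter_comm]
  have hxB := h.left_notMem hG
  have hyA := (h.swap hG).left_notMem hG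
  have hxA := h.linkA.left_notMem hG
  have hyB := h.linkB.left_notMem hG
  have hzA := h.linkA.swap.left_notMem hG
  have hzB := h.linkB.swap.left_notMem hG
  have hxy : x ≠ y := by
    rintro rfl
    have := h.xy
    rw [hG.diag] at this
    omega
  have hxz : x ≠ z := by
    rintro rfl
    have := h.yz
    rw [hG.symm, h.xy] at this
    omega
  have hyz : y ≠ z := by
    rintro rfl
    have := h.xz
    rw [h.xy] at this
    omega
  have h1 := h.left_ne_two hG hC
  have h2 := (h.swap hG).left_ne_two hG hC'
  have h3 := h.apex_ne_two hG hC
  have h4 := (h.swap hG).apex_ne_two hG hC'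
  have h5 := fun a ha b hb => h.third_ne_two hG (a := a) (b := b) hC ha hb
  simp only [mem_outer]
  simp only [mem_sdiff] at *
  by_cases hz : w u z = 2
  · obtain ⟨a, ha, hua⟩ := h3.resolve_left (not_not.2 hz)
    obtain ⟨b, hb, hub⟩ := h4.resolve_left (not_not.2 hz)
    refine ⟨a, by simp [ha], b, by simp [hb], ?_⟩
    rcases h5 a ha b hb with h5 | h5 | h5 | ⟨a', ha', hne, h5⟩ | ⟨b', hb', hne, h5⟩
    · exact ⟨x, by grind⟩
    · exact ⟨y, by grind⟩
    · exact absurd hz h5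
    · exact ⟨a', by grind⟩
    · exact ⟨b', by grind⟩
  · refine ⟨z, by simp, ?_⟩
    rcases h1 with h1 | ⟨a, ha, h1⟩ <;> rcases h2 with h2 | ⟨b, hb, h2⟩
    · exact ⟨x, by simp, y, by grind⟩
    · exact ⟨x, by simp, b, by grind⟩
    · exact ⟨a, by simp [ha], y, by grind⟩
    · exact ⟨a, by simp [ha], b, by grind⟩

/-- Distinct outer vertices of a frame have different red neighbourhoods. -/
lemma eq_of_twins (h : Frame w r x y z A B) (hG : DenseFree w r) {p q : V}
    (hp : p ∈ outer x y z A B) (hq : q ∈ outer x y z A B)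
    (hpq : ∀ v, w p v = 2 ↔ w q v = 2) : p = q := by
  have hAB : ∀ a ∈ A \ B, ∀ b ∈ B \ A, ¬ ∀ v, w a v = 2 ↔ w b v = 2 := by
    intro a ha b hb hab
    have ha' := mem_sdiff.1 ha
    have hb' := mem_sdiff.1 hb
    refine h.not_replace hG ha hb (u := a) ?_ ?_ ?_ (fun a' h' hne => ?_) (fun b' h' hne => ?_)
    · rw [hG.symm, h.linkA.left a ha'.1]
    · rw [hab, hG.symm, h.linkB.left b hb'.1]
    · rw [hG.symm, h.linkA.right a ha'.1]
    · exact h.linkA.red a ha'.1 a' h' hne.symm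
    · rw [hab]
      exact h.linkB.red b hb'.1 b' h' hne.symm
  have hsymm := hG.symm
  have hdiag := hG.diag
  have hxy := h.xy
  have hxz := h.xz
  have hyz := h.yz
  have hxA := h.linkA.left
  have hzA := h.linkA.right
  have hyB := h.linkB.left
  have hzB := h.linkB.right
  have hA := h.linkA.red
  have hB := h.linkB.red
  unfold RedClique at hA hB
  have hpp := hpq p
  have hqq := hpq q
  have hx := hpq x
  have hy := hpq y
  have hz := hpq z
  by_contra hne
  rw [mem_outer] at hp hq
  rcases hp with rfl | rfl | rfl | hp | hp <;> rcases hq with rfl | rfl | rfl | hq | hq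
  all_goals first
    | exact hAB _ hp _ hq hpq
    | exact hAB _ hq _ hp fun v => (hpq v).symm
    | (simp only [mem_sdiff] at *; grind)

end Frame

/-- Suppose vertices joined by a blue edge have equal red neighbourhoods. If `v` extends a
maximum red clique through a blue edge `ve`, then every blue edge `us` to the clique ends in `e`,
and `uv` has weight `0`. -/
lemma DenseFree.eq_of_blue [Fintype V] [DecidableEq V] {w : V → V → ℕ} {r : ℕ}
    (hG : DenseFree w r) (hP : ∀ s t v, w s t = 1 → w s v = 2 → w t v = 2) {K : Finset V}
    (hK : RedClique w K) (hc : K.card + 1 = r) {v e u s : V} (he : e ∈ K) (hve : w v e = 1)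
    (hs : s ∈ K) (hus : w u s = 1) : s = e ∧ w u v = 0 := by
  have hv : ∀ a ∈ K, a ≠ e → w v a = 2 := fun a ha hae =>
    hP e v a (by rw [hG.symm, hve]) (hK e he a ha hae.symm)
  have hv0 : ∀ a ∈ K, w v a ≠ 0 := by
    intro a ha
    by_cases hae : a = e
    · rw [hae]; omega
    · rw [hv a ha hae]; omega
  have huv : w u v = 0 := by
    obtain ⟨a, ha, hua⟩ := hG.exists_eq_zero (hG.posClique_insert hK.posClique hv0)
      (by rw [card_insert_of_notMem (hG.notMem_of_pos hv0), hc]) u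
    rcases mem_insert.1 ha with rfl | ha
    · exact hua
    by_cases has : a = s
    · rw [has] at hua; omega
    · have := hP s u a (by rw [hG.symm, hus]) (hK s hs a ha (Ne.symm has))
      omega
  refine ⟨?_, huv⟩
  by_contra hse
  have := hP s u v (by rw [hG.symm, hus]) (by rw [hG.symm, hv s hs hse])
  omega

namespace Frame

variable [Fintype V] [DecidableEq V] {w : V → V → ℕ} {r : ℕ} {x y z : V} {A B : Finset V}

lemma false_of_blue_twins_common (h : Frame w r x y z A B) (hG : DenseFree w r)
    (hP : ∀ s t v, w s t = 1 → w s v = 2 → w t v = 2) {v e : V} (he : e ∈ A ∩ B)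
    (hve : w v e = 1) : False := by
  have hA := h.card_sdiff
  have hB := h.card_sdiff'
  have hm := h.card_sdiff_pos hG
  have heC := card_erase_add_one he
  have hR := card_outer_le (x := x) (y := y) (z := z) (A := A) (B := B)
  have he' := mem_inter.1 he
  obtain ⟨u, hu⟩ := hG.exists_sum_lt ![3, 2, 2, 1]
    ![(A ∩ B).erase e, {e}, {v}, outer x y z A B] 6 (by simp [Fin.sum_univ_succ])
    (by simp [Fin.sum_univ_succ, -card_erase_of_mem]; omega)
  simp [Fin.sum_univ_succ] at hu
  have hle := hG.le_two u
  have hA' : ∀ s ∈ A, w u s = 1 → s = e ∧ w u v = 0 := fun s hs =>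
    hG.eq_of_blue hP (h.linkA.redClique_insert hG) (h.linkA.card_insert hG)
      (mem_insert_of_mem he'.1) hve (mem_insert_of_mem hs)
  have hB' : ∀ s ∈ B, w u s = 1 → s = e ∧ w u v = 0 := fun s hs =>
    hG.eq_of_blue hP (h.linkB.redClique_insert hG) (h.linkB.card_insert hG)
      (mem_insert_of_mem he'.2) hve (mem_insert_of_mem hs)
  have hx' : w u x = 1 → x = e ∧ w u v = 0 :=
    hG.eq_of_blue hP (h.linkA.redClique_insert hG) (h.linkA.card_insert hG)
      (mem_insert_of_mem he'.1) hve (mem_insert_self _ _)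
  have hy' : w u y = 1 → y = e ∧ w u v = 0 :=
    hG.eq_of_blue hP (h.linkB.redClique_insert hG) (h.linkB.card_insert hG)
      (mem_insert_of_mem he'.2) hve (mem_insert_self _ _)
  have hz' : w u z = 1 → z = e ∧ w u v = 0 :=
    hG.eq_of_blue hP (h.linkA.swap.redClique_insert hG) (h.linkA.swap.card_insert hG)
      (mem_insert_of_mem he'.1) hve (mem_insert_self _ _)
  have hout : ∀ s ∈ outer x y z A B, w u s ≠ 1 := by
    intro s hs hus
    rw [mem_outer] at hs
    rcases hs with rfl | rfl | rfl | hs | hs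
    · exact h.linkA.left_notMem hG ((hx' hus).1 ▸ he'.1)
    · exact h.linkB.left_notMem hG ((hy' hus).1 ▸ he'.2)
    · exact h.linkA.swap.left_notMem hG ((hz' hus).1 ▸ he'.1)
    · rw [mem_sdiff] at hs
      exact hs.2 ((hA' s hs.1 hus).1 ▸ he'.2)
    · rw [mem_sdiff] at hs
      exact hs.2 ((hB' s hs.1 hus).1 ▸ he'.1)
  have hue := hle e
  have huv := hle v
  have h1 := hA' e he'.1
  have h2 := hP v e u hve
  have h3 := hP e v u (by rw [hG.symm, hve])
  rw [hG.symm v u, hG.symm e u] at h2 h3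
  have he2 : w u e = 2 := by omega
  have hC : ∀ c ∈ A ∩ B, w u c = 2 := by
    intro c hc
    by_cases hce : c = e
    · rw [hce, he2]
    have := le_sum_of_mem (fun a => 2 - w u a) (mem_erase.2 ⟨hce, hc⟩)
    have := hle c
    by_contra h2
    have : w u c = 0 := by
      by_contra h0
      exact hce (hA' c (mem_inter.1 hc).1 (by omega)).1
    omega
  obtain ⟨p, hp, q, hq, t, ht, hpq, hpt, hqt, h1, h2, h3⟩ := h.exists_three hG hC
  have := add_add_le_sum_of_mem (fun a => 2 - w u a) hp hq ht hpq hpt hqt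
  have := hout p hp
  have := hout q hq
  have := hout t ht
  have := hle p
  have := hle q
  have := hle t
  omega

lemma false_of_blue_twins_outer (h : Frame w r x y z A B) (hG : DenseFree w r)
    (hP : ∀ s t v, w s t = 1 → w s v = 2 → w t v = 2) {v e : V} (he : e ∈ insert x A)
    (heC : e ∉ A ∩ B) (hve : w v e = 1) : False := by
  have hA := h.card_sdiff
  have hB := h.card_sdiff'
  have hm := h.card_sdiff_pos hG
  have hR := card_outer_le (x := x) (y := y) (z := z) (A := A) (B := B)
  have hR' := card_outer_pos (x := x) (y := y) (z := z) (A := A) (B := B)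
  obtain ⟨u, hu⟩ := hG.exists_sum_lt ![5, 2] ![A ∩ B, outer x y z A B] 10
    (by simp [Fin.sum_univ_succ, -card_pos]; omega)
    (by simp [Fin.sum_univ_succ]; omega)
  simp [Fin.sum_univ_succ] at hu
  have hle := hG.le_two u
  have hC : ∀ c ∈ A ∩ B, w u c = 2 := by
    intro c hc
    have := le_sum_of_mem (fun a => 2 - w u a) hc
    have := hle c
    by_contra h2
    have : w u c = 0 := by
      by_contra h0
      exact heC ((hG.eq_of_blue hP (h.linkA.redClique_insert hG) (h.linkA.card_insert hG) he hve
        (mem_insert_of_mem (mem_inter.1 hc).1) (u := u) (by omega)).1 ▸ hc)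
    omega
  have hblue : ∀ s ∈ outer x y z A B, ∀ t ∈ outer x y z A B, s ≠ t →
      w u s = 1 → w u t ≠ 1 := by
    intro s hs t ht hst h1 h2
    refine hst (h.eq_of_twins hG hs ht fun a => ⟨fun h3 => ?_, fun h3 => ?_⟩)
    · exact hP u t a h2 (hP s u a (by rw [hG.symm, h1]) h3)
    · exact hP u s a h1 (hP t u a (by rw [hG.symm, h2]) h3)
  obtain ⟨p, hp, q, hq, t, ht, hpq, hpt, hqt, h1, h2, h3⟩ := h.exists_three hG hC
  have := add_add_le_sum_of_mem (fun a => 2 - w u a) hp hq ht hpq hpt hqt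
  have := hblue p hp q hq hpq
  have := hblue p hp t ht hpt
  have := hblue q hq t ht hqt
  have := hle p
  have := hle q
  have := hle t
  omega

lemma false_of_blue_twins (h : Frame w r x y z A B) (hG : DenseFree w r)
    (hP : ∀ s t v, w s t = 1 → w s v = 2 → w t v = 2) : False := by
  obtain ⟨v, e, he, hve⟩ :=
    hG.exists_blue_neighbour (h.linkA.redClique_insert hG) (h.linkA.card_insert hG)
  by_cases heC : e ∈ A ∩ B
  · exact h.false_of_blue_twins_common hG hP heC hve
  · exact h.false_of_blue_twins_outer hG hP he heC hve

end Frame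

lemma Secure.exists_link [Fintype V] {w : V → V → ℕ} {r : ℕ} (hG : DenseFree w r) {x y : V}
    (h : Secure w r x y) : ∃ A, Link w r x y A := by
  obtain ⟨A, hc, -, -, hA, hxy⟩ := h
  have := hG.three_le
  exact ⟨A, by omega, hA, fun a ha => by rw [hG.symm, (hxy a ha).1],
    fun a ha => by rw [hG.symm, (hxy a ha).2]⟩

end ColouredGraph

/-- Lemma: in a `{RK_r, BK_{r+1}}`-free coloured graph with minimum degree greater than
`((14r-24)/(7r-5))·n` in which all weight-`1` edges and all weight-`0` edges are secure,
there is no wicked triangle. -/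
theorem no_wicked {V : Type*} [Fintype V] (r : ℕ) (hr : 3 ≤ r)
    (w : V → V → ℕ) (hG : IsColoured w)
    (hRK : ¬ HasSub w (RK r)) (hBK : ¬ HasSub w (BK (r + 1)))
    (hdeg : ∀ x : V,
      (14 * (r : ℝ) - 24) / (7 * (r : ℝ) - 5) * (Fintype.card V : ℝ) < ∑ y : V, (w x y : ℝ))
    (hsec1 : ∀ x y : V, x ≠ y → w x y = 1 → Secure w r x y)
    (hsec0 : ∀ x y : V, x ≠ y → w x y = 0 → Secure w r x y) :
    ∀ x y z : V, x ≠ y → x ≠ z → y ≠ z →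
      ¬ (w x y = 2 ∧ w x z ≤ 1 ∧ w y z ≤ 1) := by
  classical
  have hD := denseFree_of_minDegree hr hG hRK hBK hdeg
  have hframe : ∀ x y z, w x y = 2 → w x z ≤ 1 → w y z ≤ 1 → ∃ A B, Frame w r x y z A B := by
    intro x y z hxy hxz hyz
    have hlink : ∀ p, p ≠ z → w p z ≤ 1 → ∃ A, Link w r p z A := by
      intro p hpz hp
      rcases Nat.le_one_iff_eq_zero_or_eq_one.1 hp with hp | hp
      · exact (hsec0 p z hpz hp).exists_link hD
      · exact (hsec1 p z hpz hp).exists_link hD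
    refine exists_frame hxy hxz hyz (hlink x ?_ hxz) (hlink y ?_ hyz)
    · rintro rfl
      rw [hD.symm] at hyz
      omega
    · rintro rfl
      omega
  have hW : ∀ s t v, w s t = 2 → w s v = 1 → w t v ≠ 1 := by
    intro s t v hst hs ht
    obtain ⟨A, B, h⟩ := hframe s t v hst hs.le ht.le
    exact h.blue_blue hD hs ht
  have hP : ∀ s t v, w s t = 1 → w s v = 2 → w t v = 2 := by
    intro s t v hst hsv
    by_contra htv
    have := hD.le_two t v
    obtain ⟨A, B, h⟩ := hframe s v t hsv hst.le (by rw [hD.symm]; omega)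
    exact h.blue_of_no_blue_blue hD hst hW
  rintro x y z - - - ⟨hxy, hxz, hyz⟩
  obtain ⟨A, B, h⟩ := hframe x y z hxy hxz hyz
  exact h.false_of_blue_twins hD hP
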